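/- Let D, Y, X be finite nonempty types and Z := D × (D → Y) × X, and let ≿ be a binary relation on lotteries on Z. The following are equivalent: (1) ≿ satisfies Completeness, Transitivity, Independence, Continuity, and Irrelevance of Counterfactual Outcomes; (2) there exists a function u : D × Y × X → ℝ such that the counterfactual utility ũ(d, y, x) := u(d, y d, x) represents ≿. Moreover, any two such representing functions are related by a positive affine transformation: there exist a > 0 and b ∈ ℝ with u' = a·u + b. -/

import Mathlib

/-- `p` is a lottery on the finite type `Z`. -/
def IsLottery {Z : Type*} [Fintype Z] (p : Z → ℝ) : Prop :=
  (∀ z, 0 ≤ p z) ∧ ∑ z, p z = 1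

/-- Expected utility of lottery `p` under utility `u`. -/
noncomputable def expUtil {Z : Type*} [Fintype Z] (u p : Z → ℝ) : ℝ :=
  ∑ z, u z * p z

/-- Mixture `α p + (1 - α) q`. -/
def mix {Z : Type*} (α : ℝ) (p q : Z → ℝ) : Z → ℝ :=
  fun z => α * p z + (1 - α) * q z

/-- `u` represents the relation `R` on lotteries. -/
def Represents {Z : Type*} [Fintype Z]
    (R : (Z → ℝ) → (Z → ℝ) → Prop) (u : Z → ℝ) : Prop :=
  ∀ p q : Z → ℝ, IsLottery p → IsLottery q → (R p q ↔ expUtil u p ≥ expUtil u q)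

/-- Strict preference `p ≻ q`. -/
def StrictPref {Z : Type*} (R : (Z → ℝ) → (Z → ℝ) → Prop) (p q : Z → ℝ) : Prop :=
  R p q ∧ ¬ R q p

/-- Completeness on lotteries. -/
def CompleteAx {Z : Type*} [Fintype Z] (R : (Z → ℝ) → (Z → ℝ) → Prop) : Prop :=
  ∀ p q : Z → ℝ, IsLottery p → IsLottery q → (R p q ∨ R q p)

/-- Transitivity on lotteries. -/
def TransitiveAx {Z : Type*} [Fintype Z] (R : (Z → ℝ) → (Z → ℝ) → Prop) : Prop :=
  ∀ p q r : Z → ℝ, IsLottery p → IsLottery q → IsLottery r → R p q → R q r → R p r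

/-- vNM Independence on lotteries. -/
def IndependenceAx {Z : Type*} [Fintype Z] (R : (Z → ℝ) → (Z → ℝ) → Prop) : Prop :=
  ∀ p q r : Z → ℝ, IsLottery p → IsLottery q → IsLottery r →
    ∀ α : ℝ, 0 < α → α ≤ 1 →
      StrictPref R p q → StrictPref R (mix α p r) (mix α q r)

/-- vNM Continuity on lotteries. -/
def ContinuityAx {Z : Type*} [Fintype Z] (R : (Z → ℝ) → (Z → ℝ) → Prop) : Prop :=
  ∀ p q r : Z → ℝ, IsLottery p → IsLottery q → IsLottery r →
    StrictPref R p q → StrictPref R q r →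
      ∃ α β : ℝ, 0 < α ∧ α < 1 ∧ 0 < β ∧ β < 1 ∧
        StrictPref R (mix α p r) q ∧ StrictPref R q (mix β p r)

section PotentialOutcomeSpace

variable {D Y X : Type*} [Fintype D] [DecidableEq D] [Fintype Y] [DecidableEq Y]
  [Fintype X] [DecidableEq X]

/-- Probability that the decision equals `d` under lottery `p` on `D × (D → Y) × X`. -/
noncomputable def probDec (p : D × (D → Y) × X → ℝ) (d : D) : ℝ :=
  ∑ z, if z.1 = d then p z else 0

/-- Probability that the covariate equals `x` under lottery `p`. -/
noncomputable def probCov (p : D × (D → Y) × X → ℝ) (x : X) : ℝ :=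
  ∑ z, if z.2.2 = x then p z else 0

/-- Probability that the potential outcome coordinate `y k` equals `v` under `p`. -/
noncomputable def probOut (p : D × (D → Y) × X → ℝ) (k : D) (v : Y) : ℝ :=
  ∑ z, if z.2.1 k = v then p z else 0

end PotentialOutcomeSpace

section Stmt1

variable {D Y X : Type*} [Fintype D] [DecidableEq D] [Fintype Y] [DecidableEq Y]
  [Fintype X] [DecidableEq X]

/-- Irrelevance of Counterfactual Outcomes. -/
def IrrelevanceCounterfactualOutcomes
    (R : (D × (D → Y) × X → ℝ) → (D × (D → Y) × X → ℝ) → Prop) : Prop :=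
  ∀ p q : D × (D → Y) × X → ℝ, IsLottery p → IsLottery q →
    ∀ (d : D) (x : X),
      probDec p d = 1 → probDec q d = 1 →
      probCov p x = 1 → probCov q x = 1 →
      (∀ v : Y, probOut p d v = probOut q d v) →
      (R p q ∧ R q p)

end Stmt1

section Mix

variable {Z : Type*}

lemma mix_one (p q : Z → ℝ) : mix 1 p q = p := by
  ext z; simp [mix]

lemma mix_zero (p q : Z → ℝ) : mix 0 p q = q := by
  ext z; simp [mix]

lemma mix_self (α : ℝ) (p : Z → ℝ) : mix α p p = p := by
  ext z; simp only [mix]; ring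

lemma mix_swap (α : ℝ) (p q : Z → ℝ) : mix α p q = mix (1 - α) q p := by
  ext z; simp only [mix]; ring

lemma mix_mix_right (α β : ℝ) (p r : Z → ℝ) :
    mix β p (mix α p r) = mix (β + (1 - β) * α) p r := by
  ext z; simp only [mix]; ring

lemma mix_mix_left (α β : ℝ) (p r : Z → ℝ) : mix β (mix α p r) r = mix (β * α) p r := by
  ext z; simp only [mix]; ring

lemma mix_mix_distrib (α β : ℝ) (p q r : Z → ℝ) :
    mix β (mix α p r) (mix α q r) = mix α (mix β p q) r := by
  ext z; simp only [mix]; ring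

lemma mix_mix_mix (α β γ : ℝ) (p r : Z → ℝ) :
    mix α (mix β p r) (mix γ p r) = mix (α * β + (1 - α) * γ) p r := by
  ext z; simp only [mix]; ring

variable [Fintype Z]

lemma IsLottery.mix {p q : Z → ℝ} (hp : IsLottery p) (hq : IsLottery q) {α : ℝ}
    (h0 : 0 ≤ α) (h1 : α ≤ 1) : IsLottery (mix α p q) := by
  refine ⟨fun z => ?_, ?_⟩
  · exact add_nonneg (mul_nonneg h0 (hp.1 z)) (mul_nonneg (by linarith) (hq.1 z))
  · simp only [_root_.mix, Finset.sum_add_distrib, ← Finset.mul_sum, hp.2, hq.2]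
    ring

lemma expUtil_mix (u p q : Z → ℝ) (α : ℝ) :
    expUtil u (mix α p q) = α * expUtil u p + (1 - α) * expUtil u q := by
  simp only [expUtil, mix, Finset.mul_sum, ← Finset.sum_add_distrib]
  exact Finset.sum_congr rfl fun z _ => by ring

variable [DecidableEq Z]

lemma isLottery_single (z : Z) : IsLottery (Pi.single z 1 : Z → ℝ) :=
  single_mem_stdSimplex ℝ z

lemma expUtil_single (u : Z → ℝ) (z : Z) : expUtil u (Pi.single z 1) = u z := by
  simp [expUtil, Pi.single_apply]

/-- A property of lotteries that holds for point masses and is preserved by mixtures holds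
for all lotteries. -/
lemma IsLottery.induction {P : (Z → ℝ) → Prop} (single : ∀ z, P (Pi.single z 1))
    (mixture : ∀ p q, IsLottery p → IsLottery q → ∀ α : ℝ, 0 ≤ α → α ≤ 1 → P p → P q →
      P (_root_.mix α p q))
    {p : Z → ℝ} (hp : IsLottery p) : P p := by
  have hconv : Convex ℝ {p : Z → ℝ | IsLottery p ∧ P p} := by
    rintro p ⟨hp, hPp⟩ q ⟨hq, hPq⟩ a b ha hb hab
    obtain rfl : b = 1 - a := by linarith
    exact ⟨hp.mix hq ha (by linarith), mixture p q hp hq a ha (by linarith) hPp hPq⟩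
  have hsub : convexHull ℝ (Set.range fun z : Z => (Pi.single z 1 : Z → ℝ)) ⊆
      {p : Z → ℝ | IsLottery p ∧ P p} :=
    convexHull_min (Set.range_subset_iff.2 fun z => ⟨isLottery_single z, single z⟩) hconv
  rw [convexHull_rangle_single_eq_stdSimplex] at hsub
  exact (hsub hp).2

end Mix

section Representation

variable {Z : Type*} [Fintype Z] {R : (Z → ℝ) → (Z → ℝ) → Prop}

lemma Represents.strictPref_iff {u p q : Z → ℝ} (h : Represents R u) (hp : IsLottery p)
    (hq : IsLottery q) : StrictPref R p q ↔ expUtil u q < expUtil u p := by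
  rw [StrictPref, h p q hp hq, h q p hq hp]
  constructor
  · rintro ⟨_, h⟩; exact not_le.1 h
  · intro h; exact ⟨h.le, not_le.2 h⟩

lemma Represents.completeAx {u : Z → ℝ} (h : Represents R u) : CompleteAx R := by
  intro p q hp hq
  rw [h p q hp hq, h q p hq hp]
  exact le_total _ _

lemma Represents.transitiveAx {u : Z → ℝ} (h : Represents R u) : TransitiveAx R := by
  intro p q r hp hq hr
  rw [h p q hp hq, h q r hq hr, h p r hp hr]
  exact fun h₁ h₂ => le_trans h₂ h₁

lemma Represents.independenceAx {u : Z → ℝ} (h : Represents R u) : IndependenceAx R := by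
  intro p q r hp hq hr α h0 h1
  rw [h.strictPref_iff hp hq, h.strictPref_iff (hp.mix hr h0.le h1) (hq.mix hr h0.le h1),
    expUtil_mix, expUtil_mix]
  intro hlt
  gcongr

lemma Represents.continuityAx {u : Z → ℝ} (h : Represents R u) : ContinuityAx R := by
  intro p q r hp hq hr hpq hqr
  rw [h.strictPref_iff hp hq] at hpq
  rw [h.strictPref_iff hq hr] at hqr
  obtain ⟨t, ht⟩ : ∃ t, t = (expUtil u q - expUtil u r) / (expUtil u p - expUtil u r) := ⟨_, rfl⟩
  have hpr : 0 < expUtil u p - expUtil u r := by linarith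
  have ht0 : 0 < t := by rw [ht]; exact div_pos (by linarith) hpr
  have ht1 : t < 1 := by rw [ht, div_lt_one hpr]; linarith
  have hq' : expUtil u q = expUtil u r + t * (expUtil u p - expUtil u r) := by
    rw [ht]; field_simp; ring
  refine ⟨(1 + t) / 2, t / 2, by linarith, by linarith, by linarith, by linarith, ?_, ?_⟩
  · rw [h.strictPref_iff (hp.mix hr (by linarith) (by linarith)) hq, expUtil_mix]
    nlinarith
  · rw [h.strictPref_iff hq (hp.mix hr (by linarith) (by linarith)), expUtil_mix]
    nlinarith

/-- Two utilities representing the same relation are positive affine transforms of each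
other. -/
lemma Represents.exists_affine [Nonempty Z] {u u' : Z → ℝ} (h : Represents R u)
    (h' : Represents R u') : ∃ a b : ℝ, 0 < a ∧ ∀ z, u' z = a * u z + b := by
  classical
  have hiff : ∀ p q : Z → ℝ, IsLottery p → IsLottery q →
      (expUtil u q ≤ expUtil u p ↔ expUtil u' q ≤ expUtil u' p) := fun p q hp hq =>
    (h p q hp hq).symm.trans (h' p q hp hq)
  have hiff_single : ∀ y z, u y ≤ u z ↔ u' y ≤ u' z := fun y z => by
    simpa only [expUtil_single] using hiff _ _ (isLottery_single z) (isLottery_single y)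
  obtain ⟨b, hb⟩ := Finite.exists_max u
  obtain ⟨w, hw⟩ := Finite.exists_min u
  rcases (hw b).eq_or_lt with heq | hlt
  · refine ⟨1, u' b - u b, one_pos, fun z => ?_⟩
    have hz : u z = u b := le_antisymm (hb z) (heq ▸ hw z)
    have hz' : u' z = u' b :=
      le_antisymm ((hiff_single _ _).1 hz.le) ((hiff_single _ _).1 hz.ge)
    rw [hz, hz']; ring
  · have hlt' : u' w < u' b := lt_of_not_ge fun hle => hlt.not_ge ((hiff_single _ _).2 hle)
    have hpos : 0 < u b - u w := sub_pos.2 hlt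
    refine ⟨(u' b - u' w) / (u b - u w), u' w - (u' b - u' w) / (u b - u w) * u w,
      div_pos (sub_pos.2 hlt') hpos, fun z => ?_⟩
    obtain ⟨t, ht⟩ : ∃ t, t = (u z - u w) / (u b - u w) := ⟨_, rfl⟩
    have ht0 : 0 ≤ t := by rw [ht]; exact div_nonneg (sub_nonneg.2 (hw z)) hpos.le
    have ht1 : t ≤ 1 := by rw [ht, div_le_one hpos]; linarith [hb z]
    have hm : IsLottery (mix t (Pi.single b 1) (Pi.single w 1)) :=
      (isLottery_single b).mix (isLottery_single w) ht0 ht1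
    have hz : u z = t * u b + (1 - t) * u w := by rw [ht]; field_simp; ring
    have h₁ := hiff _ _ hm (isLottery_single z)
    have h₂ := hiff _ _ (isLottery_single z) hm
    simp only [expUtil_mix, expUtil_single] at h₁ h₂
    rw [le_antisymm (h₁.1 hz.le) (h₂.1 hz.ge), ht]
    field_simp
    ring

end Representation

/-- A total transitive relation on a finite nonempty type has a greatest element. -/
lemma exists_forall_rel_of_total_of_trans {α : Type*} [Finite α] [Nonempty α]
    {r : α → α → Prop} (htotal : ∀ a b, r a b ∨ r b a)
    (htrans : ∀ a b c, r a b → r b c → r a c) : ∃ b, ∀ a, r b a := by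
  have : IsTrans α (fun a b => r b a) := ⟨fun a b c hab hbc => htrans c b a hbc hab⟩
  have hdir : Directed (fun a b => r b a) (id : α → α) := fun a b =>
    (htotal a b).elim (fun h => ⟨a, (htotal a a).elim id id, h⟩)
      fun h => ⟨b, h, (htotal b b).elim id id⟩
  exact hdir.finite_le id

section VonNeumannMorgenstern

variable {Z : Type*} [Fintype Z] {R : (Z → ℝ) → (Z → ℝ) → Prop}

lemma CompleteAx.refl (hC : CompleteAx R) {p : Z → ℝ} (hp : IsLottery p) : R p p :=
  (hC p p hp hp).elim id id

lemma CompleteAx.strictPref_of_not (hC : CompleteAx R) {p q : Z → ℝ} (hp : IsLottery p)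
    (hq : IsLottery q) (h : ¬ R q p) : StrictPref R p q :=
  ⟨(hC p q hp hq).resolve_right h, h⟩

lemma TransitiveAx.strictPref_of_strictPref_of_pref (hT : TransitiveAx R) {p q r : Z → ℝ}
    (hp : IsLottery p) (hq : IsLottery q) (hr : IsLottery r) (hpq : StrictPref R p q)
    (hqr : R q r) : StrictPref R p r :=
  ⟨hT p q r hp hq hr hpq.1 hqr, fun h => hpq.2 (hT q r p hq hr hp hqr h)⟩

lemma TransitiveAx.strictPref_of_pref_of_strictPref (hT : TransitiveAx R) {p q r : Z → ℝ}
    (hp : IsLottery p) (hq : IsLottery q) (hr : IsLottery r) (hpq : R p q)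
    (hqr : StrictPref R q r) : StrictPref R p r :=
  ⟨hT p q r hp hq hr hpq hqr.1, fun h => hqr.2 (hT r p q hr hp hq h hpq)⟩

lemma IndependenceAx.strictPref_mix_mix (hI : IndependenceAx R) {p q : Z → ℝ}
    (hp : IsLottery p) (hq : IsLottery q) (hpq : StrictPref R p q) {a b : ℝ} (hb : 0 ≤ b)
    (hba : b < a) (ha : a ≤ 1) : StrictPref R (mix a p q) (mix b p q) := by
  have ha0 : 0 < a := hb.trans_lt hba
  have hm : IsLottery (mix a p q) := hp.mix hq ha0.le ha
  have hmq : StrictPref R (mix a p q) q := by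
    simpa only [mix_self] using hI p q q hp hq hq a ha0 ha hpq
  have hc : b / a < 1 := (div_lt_one ha0).2 hba
  have hc0 : 0 ≤ b / a := div_nonneg hb ha0.le
  have key := hI _ q _ hm hq hm (1 - b / a) (by linarith) (by linarith) hmq
  rw [mix_self, mix_swap (1 - b / a), sub_sub_cancel, mix_mix_left, div_mul_cancel₀ _ ha0.ne'] at key
  exact key

/-- Independence for weak preference. -/
lemma IndependenceAx.pref_mix (hI : IndependenceAx R) (hC : CompleteAx R)
    (hT : TransitiveAx R) (hA : ContinuityAx R) {p q r : Z → ℝ} (hp : IsLottery p)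
    (hq : IsLottery q) (hr : IsLottery r) {α : ℝ} (h0 : 0 ≤ α) (h1 : α ≤ 1) (hpq : R p q) :
    R (mix α p r) (mix α q r) := by
  rcases h0.eq_or_lt with rfl | h0
  · simpa only [mix_zero] using hC.refl hr
  by_cases hqp : R q p
  swap
  · exact (hI p q r hp hq hr α h0 h1 ⟨hpq, hqp⟩).1
  have hpr := hp.mix hr h0.le h1
  have hqr := hq.mix hr h0.le h1
  by_contra hcon
  have hlt : StrictPref R (mix α q r) (mix α p r) := hC.strictPref_of_not hqr hpr hcon
  by_cases hs : R p (mix α q r)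
  · obtain ⟨s, hsl, hs⟩ : ∃ s, IsLottery s ∧ StrictPref R p s :=
      ⟨_, hpr, hT.strictPref_of_pref_of_strictPref hp hqr hpr hs hlt⟩
    obtain ⟨t, -, ht0, ht1, -, -, ht, -⟩ := hA _ _ _ hqr hpr (hsl.mix hr h0.le h1) hlt
      (hI p s r hp hsl hr α h0 h1 hs)
    rw [mix_mix_distrib] at ht
    have hqs := hT.strictPref_of_pref_of_strictPref hq hp hsl hqp hs
    have hm := hq.mix hsl ht0.le ht1.le
    have hqm : StrictPref R q (mix t q s) := by
      simpa only [mix_one] using hI.strictPref_mix_mix hq hsl hqs ht0.le ht1 le_rfl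
    exact ht.2 (hI _ _ r hp hm hr α h0 h1
      (hT.strictPref_of_pref_of_strictPref hp hq hm hpq hqm)).1
  · obtain ⟨s, hsl, hs⟩ : ∃ s, IsLottery s ∧ StrictPref R s p :=
      ⟨_, hqr, hC.strictPref_of_not hqr hp hs⟩
    have hsq := hT.strictPref_of_strictPref_of_pref hsl hp hq hs hpq
    obtain ⟨-, t, -, -, ht0, ht1, -, ht⟩ := hA _ _ _ (hsl.mix hr h0.le h1) hqr hpr
      (hI s q r hsl hq hr α h0 h1 hsq) hlt
    rw [mix_mix_distrib] at ht
    have hm := hsl.mix hp ht0.le ht1.le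
    have hmp : StrictPref R (mix t s p) p := by
      simpa only [mix_zero] using hI.strictPref_mix_mix hsl hp hs le_rfl ht0 ht1.le
    exact ht.2 (hI _ _ r hm hq hr α h0 h1
      (hT.strictPref_of_strictPref_of_pref hm hp hq hmp hpq)).1

lemma IndependenceAx.pref_mix_mix (hI : IndependenceAx R) (hC : CompleteAx R)
    (hT : TransitiveAx R) (hA : ContinuityAx R) {p q p' q' : Z → ℝ} (hp : IsLottery p)
    (hq : IsLottery q) (hp' : IsLottery p') (hq' : IsLottery q') {α : ℝ} (h0 : 0 ≤ α)
    (h1 : α ≤ 1) (hpp : R p p') (hqq : R q q') : R (mix α p q) (mix α p' q') := by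
  refine hT _ (mix α p' q) _ (hp.mix hq h0 h1) (hp'.mix hq h0 h1) (hp'.mix hq' h0 h1)
    (hI.pref_mix hC hT hA hp hp' hq h0 h1 hpp) ?_
  rw [mix_swap α p' q, mix_swap α p' q']
  exact hI.pref_mix hC hT hA hq hq' hp' (by linarith) (by linarith) hqq

/-- A lottery ranked between `p` and `r` is indifferent to some mixture of `p` and `r`. -/
lemma IndependenceAx.exists_indifferent_mix (hI : IndependenceAx R) (hC : CompleteAx R)
    (hT : TransitiveAx R) (hA : ContinuityAx R) {p q r : Z → ℝ} (hp : IsLottery p)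
    (hq : IsLottery q) (hr : IsLottery r) (hpr : StrictPref R p r) (hpq : R p q)
    (hqr : R q r) :
    ∃ a : ℝ, 0 ≤ a ∧ a ≤ 1 ∧ R q (mix a p r) ∧ R (mix a p r) q := by
  by_cases hqp : R q p
  · exact ⟨1, zero_le_one, le_rfl, by rwa [mix_one], by rwa [mix_one]⟩
  by_cases hrq : R r q
  · exact ⟨0, le_rfl, zero_le_one, by rwa [mix_zero], by rwa [mix_zero]⟩
  obtain ⟨A, hmemA⟩ : ∃ A : Set ℝ, ∀ a, a ∈ A ↔ 0 ≤ a ∧ a ≤ 1 ∧ R q (mix a p r) :=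
    ⟨{a | 0 ≤ a ∧ a ≤ 1 ∧ R q (mix a p r)}, fun _ => Iff.rfl⟩
  have h0A : (0 : ℝ) ∈ A := (hmemA 0).2 ⟨le_rfl, zero_le_one, by rwa [mix_zero]⟩
  have hbdd : BddAbove A := ⟨1, fun a ha => ((hmemA a).1 ha).2.1⟩
  have hs0 : 0 ≤ sSup A := le_csSup hbdd h0A
  have hs1 : sSup A ≤ 1 := csSup_le ⟨0, h0A⟩ fun a ha => ((hmemA a).1 ha).2.1
  have hm : IsLottery (mix (sSup A) p r) := hp.mix hr hs0 hs1
  refine ⟨sSup A, hs0, hs1, ?_, ?_⟩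
  · by_contra hcon
    have hlt := hC.strictPref_of_not hm hq hcon
    have hspos : 0 < sSup A := hs0.lt_of_ne fun h => hrq (by
      have := hlt.1
      rwa [← h, mix_zero] at this)
    obtain ⟨t, -, ht0, ht1, -, -, ht, -⟩ := hA _ _ _ hm hq hr hlt ⟨hqr, hrq⟩
    rw [mix_mix_left] at ht
    have hts : t * sSup A < sSup A := by nlinarith
    have hts0 : 0 ≤ t * sSup A := by positivity
    obtain ⟨a, haA, hta⟩ := exists_lt_of_lt_csSup ⟨0, h0A⟩ hts
    obtain ⟨ha0, ha1, ha⟩ := (hmemA a).1 haA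
    exact ht.2 (hT _ _ _ hq (hp.mix hr ha0 ha1) (hp.mix hr hts0 (by linarith)) ha
      (hI.strictPref_mix_mix hp hr hpr hts0 hta ha1).1)
  · by_contra hcon
    have hlt := hC.strictPref_of_not hq hm hcon
    have hs_lt : sSup A < 1 := hs1.lt_of_ne fun h => hqp (by
      have := hlt.1
      rwa [h, mix_one] at this)
    obtain ⟨-, t, -, -, ht0, ht1, -, ht⟩ := hA _ _ _ hp hq hm ⟨hpq, hqp⟩ hlt
    rw [mix_mix_right] at ht
    have hmem : t + (1 - t) * sSup A ∈ A :=
      (hmemA _).2 ⟨by nlinarith, by nlinarith, ht.1⟩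
    have := le_csSup hbdd hmem
    nlinarith

/-- The von Neumann–Morgenstern theorem: existence of an expected utility representation. -/
theorem exists_represents [Nonempty Z] (hC : CompleteAx R) (hT : TransitiveAx R)
    (hI : IndependenceAx R) (hA : ContinuityAx R) : ∃ u : Z → ℝ, Represents R u := by
  classical
  have hδ : ∀ z : Z, IsLottery (Pi.single z 1 : Z → ℝ) := isLottery_single
  obtain ⟨b, hb⟩ : ∃ b : Z, ∀ z : Z, R (Pi.single b 1) (Pi.single z 1) :=
    exists_forall_rel_of_total_of_trans (fun y z => hC _ _ (hδ y) (hδ z))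
      fun x y z => hT _ _ _ (hδ x) (hδ y) (hδ z)
  obtain ⟨w, hw⟩ : ∃ w : Z, ∀ z : Z, R (Pi.single z 1) (Pi.single w 1) :=
    exists_forall_rel_of_total_of_trans (fun y z => hC _ _ (hδ z) (hδ y))
      fun x y z hxy hyz => hT _ _ _ (hδ z) (hδ y) (hδ x) hyz hxy
  by_cases hwb : R (Pi.single w 1) (Pi.single b 1)
  · have hb' : ∀ p, IsLottery p → R (Pi.single b 1) p := fun p hp =>
      hp.induction hb fun p q hp hq α h0 h1 hbp hbq => by
        simpa only [mix_self] using
          hI.pref_mix_mix hC hT hA (hδ b) (hδ b) hp hq h0 h1 hbp hbq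
    have hw' : ∀ p, IsLottery p → R p (Pi.single w 1) := fun p hp =>
      hp.induction hw fun p q hp hq α h0 h1 hpw hqw => by
        simpa only [mix_self] using
          hI.pref_mix_mix hC hT hA hp hq (hδ w) (hδ w) h0 h1 hpw hqw
    refine ⟨0, fun p q hp hq => ⟨fun _ => by simp [expUtil], fun _ => ?_⟩⟩
    exact hT _ _ _ hp (hδ w) hq (hw' p hp) (hT _ _ _ (hδ w) (hδ b) hq hwb (hb' q hq))
  have hbw : StrictPref R (Pi.single b 1) (Pi.single w 1) := ⟨hb w, hwb⟩
  choose u hu0 hu1 hu hu' using fun z =>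
    hI.exists_indifferent_mix hC hT hA (hδ b) (hδ z) (hδ w) hbw (hb z) (hw z)
  have key : ∀ p, IsLottery p → 0 ≤ expUtil u p ∧ expUtil u p ≤ 1 ∧
      R p (mix (expUtil u p) (Pi.single b 1) (Pi.single w 1)) ∧
      R (mix (expUtil u p) (Pi.single b 1) (Pi.single w 1)) p := by
    intro p hp
    refine hp.induction (P := fun p => 0 ≤ expUtil u p ∧ expUtil u p ≤ 1 ∧
      R p (mix (expUtil u p) (Pi.single b 1) (Pi.single w 1)) ∧
      R (mix (expUtil u p) (Pi.single b 1) (Pi.single w 1)) p) (fun z => ?_) ?_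
    · rw [expUtil_single]
      exact ⟨hu0 z, hu1 z, hu z, hu' z⟩
    · rintro p q hp hq α h0 h1 ⟨hp0, hp1, hpm, hmp⟩ ⟨hq0, hq1, hqm, hmq⟩
      have hpl := (hδ b).mix (hδ w) hp0 hp1
      have hql := (hδ b).mix (hδ w) hq0 hq1
      rw [expUtil_mix, ← mix_mix_mix]
      exact ⟨by nlinarith, by nlinarith,
        hI.pref_mix_mix hC hT hA hp hq hpl hql h0 h1 hpm hqm,
        hI.pref_mix_mix hC hT hA hpl hql hp hq h0 h1 hmp hmq⟩
  refine ⟨u, fun p q hp hq => ?_⟩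
  obtain ⟨hp0, hp1, hpm, hmp⟩ := key p hp
  obtain ⟨hq0, hq1, hqm, hmq⟩ := key q hq
  have hpl := (hδ b).mix (hδ w) hp0 hp1
  have hql := (hδ b).mix (hδ w) hq0 hq1
  constructor
  · intro hpq
    by_contra! hlt
    exact (hI.strictPref_mix_mix (hδ b) (hδ w) hbw hp0 hlt hq1).2
      (hT _ _ _ hpl hp hql hmp (hT _ _ _ hp hq hql hpq hqm))
  · intro hle
    refine hT _ _ _ hp hpl hq hpm (hT _ _ _ hpl hql hq ?_ hmq)
    rcases hle.lt_or_eq with hlt | heq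
    · exact (hI.strictPref_mix_mix (hδ b) (hδ w) hbw hq0 hlt hp1).1
    · rw [heq]
      exact hC.refl hpl

end VonNeumannMorgenstern

section CounterfactualOutcomes

variable {D Y X : Type*} [Fintype D] [DecidableEq D] [Fintype Y] [DecidableEq Y]
  [Fintype X] [DecidableEq X]

/-- A lottery gives probability zero to every point outside an event of probability one. -/
lemma IsLottery.eq_zero_of_sum_ite_eq_one {Z : Type*} [Fintype Z] {p : Z → ℝ}
    (hp : IsLottery p) {P : Z → Prop} [DecidablePred P]
    (h : ∑ z, (if P z then p z else 0) = 1) {z : Z} (hz : ¬ P z) : p z = 0 := by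
  have hle : ∀ y ∈ Finset.univ, (if P y then p y else 0) ≤ p y := fun y _ => by
    split_ifs
    exacts [le_rfl, hp.1 y]
  have := (Finset.sum_eq_sum_iff_of_le hle).1 (h.trans hp.2.symm) z (Finset.mem_univ z)
  rw [if_neg hz] at this
  exact this.symm

/-- When decision and covariate are almost surely constant, the expectation of a standard
utility depends only on the marginal of the realized outcome. -/
lemma expUtil_eq_sum_probOut (u : D × Y × X → ℝ) {p : D × (D → Y) × X → ℝ}
    (hp : IsLottery p) {d : D} {x : X} (hd : probDec p d = 1) (hx : probCov p x = 1) :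
    expUtil (fun z => u (z.1, z.2.1 z.1, z.2.2)) p = ∑ v, u (d, v, x) * probOut p d v := by
  simp only [expUtil, probOut, Finset.mul_sum, mul_ite, mul_zero]
  rw [Finset.sum_comm]
  refine Finset.sum_congr rfl fun z _ => ?_
  rw [Finset.sum_ite_eq, if_pos (Finset.mem_univ _)]
  by_cases hzd : z.1 = d
  · by_cases hzx : z.2.2 = x
    · rw [hzd, hzx]
    · rw [hp.eq_zero_of_sum_ite_eq_one (P := fun z => z.2.2 = x) hx hzx, mul_zero, mul_zero]
  · rw [hp.eq_zero_of_sum_ite_eq_one (P := fun z => z.1 = d) hd hzd, mul_zero, mul_zero]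

lemma Represents.irrelevanceCounterfactualOutcomes
    {R : (D × (D → Y) × X → ℝ) → (D × (D → Y) × X → ℝ) → Prop} {u : D × Y × X → ℝ}
    (h : Represents R (fun z => u (z.1, z.2.1 z.1, z.2.2))) :
    IrrelevanceCounterfactualOutcomes R := by
  intro p q hp hq d x hpd hqd hpx hqx hout
  have heq : expUtil (fun z => u (z.1, z.2.1 z.1, z.2.2)) p =
      expUtil (fun z => u (z.1, z.2.1 z.1, z.2.2)) q := by
    rw [expUtil_eq_sum_probOut u hp hpd hpx, expUtil_eq_sum_probOut u hq hqd hqx]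
    simp only [hout]
  exact ⟨(h p q hp hq).2 heq.ge, (h q p hq hp).2 heq.le⟩

/-- Under irrelevance of counterfactual outcomes, a representing utility only depends on the
outcome of the chosen decision. -/
lemma Represents.eq_of_irrelevance
    {R : (D × (D → Y) × X → ℝ) → (D × (D → Y) × X → ℝ) → Prop}
    {u : D × (D → Y) × X → ℝ} (h : Represents R u)
    (hirr : IrrelevanceCounterfactualOutcomes R) (d : D) {y y' : D → Y} (x : X)
    (hy : y d = y' d) : u (d, y, x) = u (d, y', x) := by
  have hδ := isLottery_single (Z := D × (D → Y) × X)
  have hsum : ∀ (P : D × (D → Y) × X → Prop) [DecidablePred P] (z₀ : D × (D → Y) × X),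
      (∑ z, if P z then (Pi.single z₀ 1 : D × (D → Y) × X → ℝ) z else 0) =
        if P z₀ then 1 else 0 := by
    intro P _ z₀
    rw [Finset.sum_eq_single z₀ (fun z _ hz => by simp [hz]) (by simp), Pi.single_eq_same]
  obtain ⟨h₁, h₂⟩ := hirr _ _ (hδ (d, y, x)) (hδ (d, y', x)) d x
    (by rw [probDec, hsum, if_pos rfl]) (by rw [probDec, hsum, if_pos rfl])
    (by rw [probCov, hsum, if_pos rfl]) (by rw [probCov, hsum, if_pos rfl])
    fun v => by simp only [probOut, hsum, hy]
  rw [h _ _ (hδ _) (hδ _), expUtil_single, expUtil_single] at h₁ h₂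
  exact le_antisymm h₂ h₁

end CounterfactualOutcomes

/-- Preferences satisfying the vNM axioms together with Irrelevance of Counterfactual
Outcomes are exactly those represented by a standard utility `ũ(d, y, x) = u(d, y d, x)`;
moreover the representing function is unique up to a positive affine transformation. -/
theorem standard_utility_representation
    (D Y X : Type*) [Fintype D] [DecidableEq D] [Nonempty D]
    [Fintype Y] [DecidableEq Y] [Nonempty Y]
    [Fintype X] [DecidableEq X] [Nonempty X]
    (R : (D × (D → Y) × X → ℝ) → (D × (D → Y) × X → ℝ) → Prop) :
    ((CompleteAx R ∧ TransitiveAx R ∧ IndependenceAx R ∧ ContinuityAx R ∧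
        IrrelevanceCounterfactualOutcomes R) ↔
      ∃ u : D × Y × X → ℝ,
        Represents R (fun z => u (z.1, z.2.1 z.1, z.2.2))) ∧
    (∀ u u' : D × Y × X → ℝ,
      Represents R (fun z => u (z.1, z.2.1 z.1, z.2.2)) →
      Represents R (fun z => u' (z.1, z.2.1 z.1, z.2.2)) →
      ∃ a b : ℝ, 0 < a ∧ ∀ w : D × Y × X, u' w = a * u w + b) := by
  refine ⟨⟨?_, ?_⟩, fun u u' h h' => ?_⟩
  · rintro ⟨hC, hT, hI, hA, hirr⟩
    obtain ⟨u, hu⟩ := exists_represents hC hT hI hA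
    refine ⟨fun w => u (w.1, fun _ => w.2.1, w.2.2), ?_⟩
    convert! hu using 1
    ext ⟨d, y, x⟩
    exact hu.eq_of_irrelevance hirr d x rfl
  · rintro ⟨u, hu⟩
    exact ⟨hu.completeAx, hu.transitiveAx, hu.independenceAx, hu.continuityAx,
      hu.irrelevanceCounterfactualOutcomes⟩
  · obtain ⟨a, b, ha, hab⟩ := h.exists_affine h'
    exact ⟨a, b, ha, fun ⟨d, v, x⟩ => hab (d, fun _ => v, x)⟩
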